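/- arXiv:1203.6237 — 5 statements merged into one kernel-verified Lean document; each statement's English description precedes it below -/
import Mathlib

section
/- There is an absolute constant c > 0 such that for all finite sets A, B ⊆ ℝ with |A| ≥ 2 and |B| ≥ 2, one has |(A−B)·(A−B)| ≥ c·|A||B|/(log|A| + log|B|). -/
open Pointwise

open Finset in
/-- The ordered pairs of elements of `S` on which `f` takes the same value. -/
def fiberPairs {α β : Type*} [DecidableEq β] (S : Finset α) (f : α → β) : Finset (α × α) :=
  {p ∈ S ×ˢ S | f p.1 = f p.2}

section FiberPairs

open Finset

variable {α β γ : Type*} [DecidableEq β] [DecidableEq γ]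

theorem mem_fiberPairs {S : Finset α} {f : α → β} {p : α × α} :
    p ∈ fiberPairs S f ↔ (p.1 ∈ S ∧ p.2 ∈ S) ∧ f p.1 = f p.2 := by
  simp [fiberPairs]

theorem card_filter_eq_sum_mul {α' : Type*} (S : Finset α) (T : Finset α') (f : α → β)
    (g : α' → β) (Y : Finset β) (hf : ∀ x ∈ S, f x ∈ Y) :
    #{p ∈ S ×ˢ T | f p.1 = g p.2} = ∑ y ∈ Y, #{x ∈ S | f x = y} * #{x ∈ T | g x = y} := by
  classical
  rw [card_eq_sum_card_fiberwise (f := fun p : α × α' => f p.1) (t := Y)]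
  · refine sum_congr rfl fun y _ => ?_
    rw [← card_product]
    congr 1
    ext p
    simp only [mem_filter, mem_product]
    constructor
    · rintro ⟨⟨⟨h1, h2⟩, h3⟩, h4⟩
      exact ⟨⟨h1, h4⟩, h2, h3 ▸ h4⟩
    · rintro ⟨⟨h1, h4⟩, h2, h3⟩
      exact ⟨⟨⟨h1, h2⟩, h4.trans h3.symm⟩, h4⟩
  · intro p hp
    simp only [coe_filter, mem_product, Set.mem_ofPred_eq] at hp
    exact hf _ hp.1.1

theorem card_fiberPairs (S : Finset α) (f : α → β) (Y : Finset β) (hf : ∀ x ∈ S, f x ∈ Y) :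
    #(fiberPairs S f) = ∑ y ∈ Y, #{x ∈ S | f x = y} ^ 2 := by
  simp_rw [sq]
  exact card_filter_eq_sum_mul S S f f Y hf

theorem sq_card_filter_eq_le {α' : Type*} (S : Finset α) (T : Finset α') (f : α → β)
    (g : α' → β) :
    #{p ∈ S ×ˢ T | f p.1 = g p.2} ^ 2 ≤ #(fiberPairs S f) * #(fiberPairs T g) := by
  classical
  rw [card_filter_eq_sum_mul S T f g (S.image f ∪ T.image g)
      (fun x hx => mem_union_left _ (mem_image_of_mem _ hx)),
    card_fiberPairs S f (S.image f ∪ T.image g)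
      (fun x hx => mem_union_left _ (mem_image_of_mem _ hx)),
    card_fiberPairs T g (S.image f ∪ T.image g)
      (fun x hx => mem_union_right _ (mem_image_of_mem _ hx))]
  exact sum_mul_sq_le_sq_mul_sq _ _ _

theorem card_fiberPairs_le_mul (S : Finset α) (f : α → β) (k : α → γ) (T : Finset γ)
    (hk : ∀ x ∈ S, k x ∈ T) :
    #(fiberPairs S f) ≤ #T * #(fiberPairs S fun x => (f x, k x)) := by
  classical
  rw [card_fiberPairs S f (S.image f) (fun x hx => mem_image_of_mem _ hx),
    card_fiberPairs S (fun x => (f x, k x)) (S.image f ×ˢ T)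
      (fun x hx => mem_product.2 ⟨mem_image_of_mem _ hx, hk x hx⟩), sum_product, mul_sum]
  refine sum_le_sum fun y _ => ?_
  have h : #{x ∈ S | f x = y} = ∑ z ∈ T, #{x ∈ S | (f x, k x) = (y, z)} := by
    rw [card_eq_sum_card_fiberwise (f := k) (t := T)]
    · refine sum_congr rfl fun z _ => ?_
      rw [filter_filter]
      simp only [Prod.mk.injEq]
    · intro x hx
      simp only [coe_filter, Set.mem_ofPred_eq] at hx
      exact hk x hx.1
  rw [h]
  exact sq_sum_le_card_mul_sum_sq

theorem sq_card_le_mul_card_fiberPairs (S : Finset α) (f : α → β) (T : Finset β)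
    (hf : ∀ x ∈ S, f x ∈ T) : #S ^ 2 ≤ #T * #(fiberPairs S f) := by
  classical
  have h := card_fiberPairs_le_mul S (fun _ => ()) f T hf
  have h1 : fiberPairs S (fun _ => ()) = S ×ˢ S := by simp [fiberPairs]
  have h2 : fiberPairs S (fun x => ((), f x)) = fiberPairs S f := by simp [fiberPairs]
  rw [h1, h2, card_product] at h
  rwa [sq]

theorem fiberPairs_subset (S : Finset α) (f : α → β) (g : α → γ)
    (h : ∀ x ∈ S, ∀ y ∈ S, f x = f y → g x = g y) : fiberPairs S f ⊆ fiberPairs S g := by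
  intro p hp
  rw [mem_fiberPairs] at hp ⊢
  exact ⟨hp.1, h _ hp.1.1 _ hp.1.2 hp.2⟩

end FiberPairs

section Incidences

open Finset

/-- A finite set of reals splits into `t` intervals of roughly equal size. -/
theorem exists_monotone_equipartition (A : Finset ℝ) {t : ℕ} (ht : 1 ≤ t) (htA : t ≤ #A) :
    ∃ f : ℝ → ℕ, Monotone f ∧ (∀ a ∈ A, f a < t) ∧ t * #(fiberPairs A f) ≤ 2 * #A ^ 2 := by
  classical
  set q := #A / t + 1 with hq
  set rank : ℝ → ℕ := fun x => #{a ∈ A | a < x} with hrank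
  have hmono : Monotone rank := fun x y hxy =>
    card_le_card (monotone_filter_right A fun a _ h => lt_of_lt_of_le h hxy)
  have hlt : ∀ x ∈ A, ∀ y, x < y → rank x < rank y := by
    intro x hx y hxy
    refine card_lt_card ⟨monotone_filter_right A fun a _ h => h.trans hxy, fun h => ?_⟩
    have := h (mem_filter.2 ⟨hx, hxy⟩)
    simp at this
  have hinj : Set.InjOn rank A := by
    intro x hx y hy hxy
    rcases lt_trichotomy x y with h | h | h
    · exact absurd hxy (hlt x hx y h).ne
    · exact h
    · exact absurd hxy (hlt y hy x h).ne'
  have hqt : #A < q * t := by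
    rw [hq, mul_comm]
    exact Nat.lt_mul_div_succ _ ht
  have hqt2 : t * q ≤ 2 * #A := by
    have := Nat.mul_div_le #A t
    rw [hq, mul_add]
    omega
  have hfib : ∀ i, #{a ∈ A | rank a / q = i} ≤ q := by
    intro i
    calc #{a ∈ A | rank a / q = i} ≤ #(Ico (i * q) (i * q + q)) := by
          refine card_le_card_of_injOn rank ?_ (hinj.mono (coe_subset.2 (filter_subset _ _)))
          intro a ha
          simp only [coe_filter, Set.mem_ofPred_eq] at ha
          have h1 := Nat.div_mul_le_self (rank a) q
          have h2 := Nat.lt_div_mul_add (a := rank a) (b := q) (Nat.succ_pos _)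
          rw [ha.2] at h1 h2
          simp [h1, h2]
      _ = q := by simp
  refine ⟨fun x => rank x / q, fun x y h => Nat.div_le_div_right (hmono h), fun a _ => ?_, ?_⟩
  · refine Nat.div_lt_of_lt_mul (lt_of_le_of_lt ?_ hqt)
    exact card_le_card (filter_subset _ _)
  · have h : #(fiberPairs A fun x => rank x / q) ≤ #A * q := by
      rw [card_fiberPairs A _ (A.image fun x => rank x / q) fun x hx => mem_image_of_mem _ hx]
      conv_rhs => rw [card_eq_sum_card_image (fun x => rank x / q) A, sum_mul]
      exact sum_le_sum fun i _ => by
        rw [sq]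
        exact Nat.mul_le_mul_left _ (hfib i)
    calc t * #(fiberPairs A fun x => rank x / q) ≤ t * (#A * q) := Nat.mul_le_mul_left _ h
      _ = #A * (t * q) := by ring
      _ ≤ #A * (2 * #A) := Nat.mul_le_mul_left _ hqt2
      _ = 2 * #A ^ 2 := by ring

/-- The number of pairs of points of `A × B` lying on a common line `x + r * y = c`. -/
noncomputable def dilateEnergy (A B : Finset ℝ) (r : ℝ) : ℕ :=
  #(fiberPairs (A ×ˢ B) fun p => p.1 + r * p.2)

theorem dilateEnergy_swap (A B : Finset ℝ) {r : ℝ} (hr : r ≠ 0) :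
    dilateEnergy B A r ≤ dilateEnergy A B r⁻¹ := by
  refine card_le_card_of_injOn (fun p => (p.1.swap, p.2.swap)) ?_ ?_
  · intro p hp
    simp only [mem_coe, mem_fiberPairs, mem_product] at hp ⊢
    refine ⟨⟨hp.1.1.symm, hp.1.2.symm⟩, ?_⟩
    have h := hp.2
    simp only [Prod.fst_swap, Prod.snd_swap]
    field_simp
    linarith
  · rintro ⟨⟨a, b⟩, c, d⟩ _ ⟨⟨a', b'⟩, c', d'⟩ _ h
    simp only [Prod.swap_prod_mk, Prod.mk.injEq] at h ⊢
    tauto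

theorem dilateEnergy_le (A B : Finset ℝ) {r : ℝ} (hr : r ≠ 0) :
    dilateEnergy A B r ≤ #A * #B * min #A #B := by
  rw [mul_min]
  refine le_min ?_ ?_
  · calc dilateEnergy A B r ≤ #((A ×ˢ B) ×ˢ A) := by
          refine card_le_card_of_injOn (fun p => (p.1, p.2.1)) ?_ ?_
          · intro p hp
            simp only [mem_coe, mem_fiberPairs, mem_product] at hp ⊢
            exact ⟨hp.1.1, hp.1.2.1⟩
          · rintro ⟨⟨a, b⟩, c, d⟩ h1 ⟨⟨a', b'⟩, c', d'⟩ h2 h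
            simp only [mem_coe, mem_fiberPairs] at h1 h2
            simp only [Prod.mk.injEq] at h ⊢
            obtain ⟨⟨rfl, rfl⟩, rfl⟩ := h
            refine ⟨⟨rfl, rfl⟩, rfl, mul_left_cancel₀ hr ?_⟩
            linarith [h1.2, h2.2]
      _ = #A * #B * #A := by simp only [card_product]
  · calc dilateEnergy A B r ≤ #((A ×ˢ B) ×ˢ B) := by
          refine card_le_card_of_injOn (fun p => (p.1, p.2.2)) ?_ ?_
          · intro p hp
            simp only [mem_coe, mem_fiberPairs, mem_product] at hp ⊢
            exact ⟨hp.1.1, hp.1.2.2⟩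
          · rintro ⟨⟨a, b⟩, c, d⟩ h1 ⟨⟨a', b'⟩, c', d'⟩ h2 h
            simp only [mem_coe, mem_fiberPairs] at h1 h2
            simp only [Prod.mk.injEq] at h ⊢
            obtain ⟨⟨rfl, rfl⟩, rfl⟩ := h
            refine ⟨⟨rfl, rfl⟩, ?_, rfl⟩
            linarith [h1.2, h2.2]
      _ = #A * #B * #B := by simp only [card_product]

/-- A line meets at most `2 * t` cells of a `t × t` grid, so a positive proportion of the pairs
of collinear points share a cell. -/
theorem dilateEnergy_le_cells (A B : Finset ℝ) {r : ℝ} (hr : r ≠ 0) {t : ℕ} {f g : ℝ → ℕ}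
    (hf : Monotone f) (hg : Monotone g) (hfA : ∀ a ∈ A, f a < t) (hgB : ∀ b ∈ B, g b < t) :
    dilateEnergy A B r ≤
      2 * t * #(fiberPairs (A ×ˢ B) fun p => (p.1 + r * p.2, f p.1, g p.2)) := by
  set k : ℝ × ℝ → ℕ := fun p => if r < 0 then f p.1 + g p.2 else f p.1 + (t - g p.2) with hk
  have hkT : ∀ p ∈ A ×ˢ B, k p ∈ range (2 * t) := by
    intro p hp
    rw [mem_product] at hp
    have h1 := hfA _ hp.1
    have h2 := hgB _ hp.2
    simp only [hk, mem_range]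
    split_ifs <;> omega
  refine (card_fiberPairs_le_mul (A ×ˢ B) (fun p => p.1 + r * p.2) k _ hkT).trans ?_
  rw [card_range]
  refine Nat.mul_le_mul_left _ (card_le_card (fiberPairs_subset _ _ _ ?_))
  rintro ⟨a, b⟩ hab ⟨a', b'⟩ hab' h
  rw [mem_product] at hab hab'
  have ha := hfA _ hab.1
  have ha' := hfA _ hab'.1
  have hb := hgB _ hab.2
  have hb' := hgB _ hab'.2
  simp only [hk, Prod.mk.injEq] at h ha ha' hb hb' ⊢
  obtain ⟨h, hkey⟩ := h
  refine ⟨h, ?_⟩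
  split_ifs at hkey with hr0
  · rcases le_total b b' with hbb | hbb
    · have h1 := hg hbb
      have h2 : f a ≤ f a' := hf (by nlinarith)
      omega
    · have h1 := hg hbb
      have h2 : f a' ≤ f a := hf (by nlinarith)
      omega
  · have hr1 : 0 < r := lt_of_le_of_ne (not_lt.1 hr0) hr.symm
    rcases le_total b b' with hbb | hbb
    · have h1 := hg hbb
      have h2 : f a' ≤ f a := hf (by nlinarith)
      omega
    · have h1 := hg hbb
      have h2 : f a ≤ f a' := hf (by nlinarith)
      omega

/-- Two distinct points lie on at most one line with slope in a prescribed family. -/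
theorem sum_card_fiberPairs_cells_le (A B R : Finset ℝ) (f g : ℝ → ℕ) :
    ∑ r ∈ R, #(fiberPairs (A ×ˢ B) fun p => (p.1 + r * p.2, f p.1, g p.2)) ≤
      #R * (#A * #B) + #(fiberPairs A f) * #(fiberPairs B g) := by
  classical
  set F : ℝ → Finset ((ℝ × ℝ) × ℝ × ℝ) :=
    fun r => fiberPairs (A ×ˢ B) fun p => (p.1 + r * p.2, f p.1, g p.2) with hF
  have hsplit : ∀ r ∈ R, #(F r) ≤ #A * #B + #{p ∈ F r | p.1 ≠ p.2} := by
    intro r _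
    rw [← card_filter_add_card_filter_not (s := F r) (fun p => p.1 = p.2)]
    refine Nat.add_le_add_right ?_ _
    rw [← card_product]
    refine card_le_card_of_injOn Prod.fst ?_ ?_
    · intro p hp
      simp only [hF, coe_filter, mem_fiberPairs, Set.mem_ofPred_eq] at hp
      exact hp.1.1.1
    · intro p hp q hq h
      simp only [coe_filter, Set.mem_ofPred_eq] at hp hq
      exact Prod.ext h (hp.2.symm.trans (h.trans hq.2))
  have hoff : ∑ r ∈ R, #{p ∈ F r | p.1 ≠ p.2} ≤ #(fiberPairs A f) * #(fiberPairs B g) := by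
    rw [← card_biUnion, ← card_product]
    · refine card_le_card_of_injOn (fun p => ((p.1.1, p.2.1), p.1.2, p.2.2)) ?_ ?_
      · intro p hp
        simp only [coe_biUnion, Set.mem_iUnion, coe_filter, hF, mem_fiberPairs, mem_product,
          Prod.mk.injEq, Set.mem_ofPred_eq] at hp
        obtain ⟨r, _, hp⟩ := hp
        simp only [mem_coe, mem_product, mem_fiberPairs]
        tauto
      · rintro ⟨⟨a, b⟩, c, d⟩ _ ⟨⟨a', b'⟩, c', d'⟩ _ h
        simp only [Prod.mk.injEq] at h ⊢
        tauto
    · intro r _ s _ hrs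
      rw [Function.onFun, disjoint_left]
      rintro ⟨⟨a, b⟩, c, d⟩ h1 h2
      simp only [hF, mem_filter, mem_fiberPairs, Prod.mk.injEq, ne_eq] at h1 h2
      have e1 := h1.1.2.1
      have e2 := h2.1.2.1
      have hbd : (r - s) * (b - d) = 0 := by linear_combination e1 - e2
      rcases mul_eq_zero.1 hbd with h | h
      · exact hrs (sub_eq_zero.1 h)
      · have hb : b = d := sub_eq_zero.1 h
        subst hb
        exact h1.2 ⟨by linarith, rfl⟩
  calc ∑ r ∈ R, #(F r) ≤ ∑ r ∈ R, (#A * #B + #{p ∈ F r | p.1 ≠ p.2}) := sum_le_sum hsplit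
    _ = #R * (#A * #B) + ∑ r ∈ R, #{p ∈ F r | p.1 ≠ p.2} := by
        rw [sum_add_distrib, sum_const, smul_eq_mul]
    _ ≤ _ := Nat.add_le_add_left hoff _

/-- Few dilates have large energy. -/
theorem card_mul_sq_le_of_le_dilateEnergy (A B R : Finset ℝ) (hR0 : 0 ∉ R) {τ : ℕ}
    (hN : 0 < #A * #B) (hτ : 4 * (#A * #B) ≤ τ) (hR : ∀ r ∈ R, τ ≤ dilateEnergy A B r) :
    #R * τ ^ 2 ≤ 128 * (#A * #B) ^ 3 := by
  rcases R.eq_empty_or_nonempty with rfl | ⟨r₀, hr₀⟩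
  · simp
  set N := #A * #B with hNdef
  set t := τ / (4 * N) with ht
  have hpos : 0 < 4 * N := by omega
  have ht1 : 1 ≤ t := (Nat.one_le_div_iff hpos).2 hτ
  have htτ : 4 * N * t ≤ τ := Nat.mul_div_le _ _
  have htτ' : τ ≤ 8 * N * t := by
    have h1 : τ < 4 * N * (t + 1) := Nat.lt_mul_div_succ _ hpos
    nlinarith
  have htmin : t ≤ min #A #B := by
    have h1 := (hR r₀ hr₀).trans (dilateEnergy_le A B fun h => hR0 (h ▸ hr₀))
    have h2 : N * t ≤ N * min #A #B := by nlinarith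
    exact Nat.le_of_mul_le_mul_left h2 hN
  obtain ⟨f, hf, hfA, hfc⟩ := exists_monotone_equipartition A ht1 (htmin.trans (min_le_left _ _))
  obtain ⟨g, hg, hgB, hgc⟩ := exists_monotone_equipartition B ht1 (htmin.trans (min_le_right _ _))
  have hsum : #R * τ ≤ 2 * t * (#R * N + #(fiberPairs A f) * #(fiberPairs B g)) :=
    calc #R * τ = ∑ r ∈ R, τ := by rw [sum_const, smul_eq_mul]
      _ ≤ ∑ r ∈ R, 2 * t * #(fiberPairs (A ×ˢ B) fun p => (p.1 + r * p.2, f p.1, g p.2)) :=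
          sum_le_sum fun r hr => (hR r hr).trans
            (dilateEnergy_le_cells A B (fun h => hR0 (h ▸ hr)) hf hg hfA hgB)
      _ ≤ _ := by
          rw [← mul_sum]
          exact Nat.mul_le_mul_left _ (sum_card_fiberPairs_cells_le A B R f g)
  set X := #(fiberPairs A f) * #(fiberPairs B g) with hX
  have hXt : t ^ 2 * X ≤ 4 * N ^ 2 :=
    calc t ^ 2 * X = (t * #(fiberPairs A f)) * (t * #(fiberPairs B g)) := by rw [hX]; ring
      _ ≤ (2 * #A ^ 2) * (2 * #B ^ 2) := Nat.mul_le_mul hfc hgc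
      _ = 4 * N ^ 2 := by rw [hNdef]; ring
  have h1 : #R * τ ≤ 4 * t * X := by
    have := Nat.mul_le_mul_left #R htτ
    nlinarith
  calc #R * τ ^ 2 = #R * τ * τ := by ring
    _ ≤ 4 * t * X * (8 * N * t) := Nat.mul_le_mul h1 htτ'
    _ = 32 * N * (t ^ 2 * X) := by ring
    _ ≤ 32 * N * (4 * N ^ 2) := Nat.mul_le_mul_left _ hXt
    _ = 128 * N ^ 3 := by ring

theorem sum_sq_dilateEnergy_le (A B R : Finset ℝ) (hR0 : 0 ∉ R) (hN : 0 < #A * #B)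
    (hR : ∀ r ∈ R, 8 * (#A * #B) ≤ dilateEnergy A B r) :
    ∑ r ∈ R, dilateEnergy A B r ^ 2 ≤
      (Nat.log 2 ((#A * #B) ^ 2) + 1) * (512 * (#A * #B) ^ 3) := by
  set N := #A * #B with hNdef
  have hmaps : ∀ r ∈ R, Nat.log 2 (dilateEnergy A B r) ∈ range (Nat.log 2 (N ^ 2) + 1) := by
    intro r _
    rw [mem_range, Nat.lt_succ_iff]
    refine Nat.log_mono_right ?_
    calc dilateEnergy A B r ≤ #((A ×ˢ B) ×ˢ (A ×ˢ B)) := card_le_card (filter_subset _ _)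
      _ = N ^ 2 := by rw [card_product, card_product, sq]
  rw [← sum_fiberwise_of_maps_to hmaps]
  refine (sum_le_card_nsmul _ _ (512 * N ^ 3) fun j _ => ?_).trans_eq
    (by rw [card_range, smul_eq_mul])
  set U := {r ∈ R | Nat.log 2 (dilateEnergy A B r) = j} with hU
  have hlow : ∀ r ∈ U, 2 ^ j ≤ dilateEnergy A B r := by
    intro r hr
    rw [hU, mem_filter] at hr
    rw [← hr.2]
    have := hR r hr.1
    exact Nat.pow_log_le_self 2 (by omega)
  have hup : ∀ r ∈ U, dilateEnergy A B r < 2 * 2 ^ j := by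
    intro r hr
    rw [hU, mem_filter] at hr
    rw [← hr.2, ← pow_succ']
    exact Nat.lt_pow_succ_log_self one_lt_two _
  rcases U.eq_empty_or_nonempty with hU0 | ⟨r₀, hr₀⟩
  · simp [hU0]
  have hj : 4 * N ≤ 2 ^ j := by
    have h1 := hup r₀ hr₀
    have h2 := hR r₀ (mem_filter.1 hr₀).1
    omega
  have hcard := card_mul_sq_le_of_le_dilateEnergy A B U
    (fun h => hR0 (mem_filter.1 h).1) hN hj hlow
  calc ∑ r ∈ U, dilateEnergy A B r ^ 2 ≤ ∑ r ∈ U, (2 * 2 ^ j) ^ 2 :=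
        sum_le_sum fun r hr => Nat.pow_le_pow_left (hup r hr).le 2
    _ = 4 * (#U * (2 ^ j) ^ 2) := by rw [sum_const, smul_eq_mul]; ring
    _ ≤ 4 * (128 * N ^ 3) := Nat.mul_le_mul_left _ hcard
    _ = 512 * N ^ 3 := by ring

end Incidences

section Differences

open Finset

/-- The pairs in `A × B` with nonzero difference. -/
noncomputable def distinctPairs (A B : Finset ℝ) : Finset (ℝ × ℝ) :=
  {p ∈ A ×ˢ B | p.1 - p.2 ≠ 0}

theorem mem_distinctPairs {A B : Finset ℝ} {p : ℝ × ℝ} :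
    p ∈ distinctPairs A B ↔ (p.1 ∈ A ∧ p.2 ∈ B) ∧ p.1 - p.2 ≠ 0 := by
  simp [distinctPairs]

/-- The ratio of the differences of two pairs. -/
noncomputable def diffRatio (p : (ℝ × ℝ) × ℝ × ℝ) : ℝ :=
  (p.1.1 - p.1.2) / (p.2.1 - p.2.2)

theorem card_le_two_mul_card_distinctPairs (A B : Finset ℝ) (hA : 2 ≤ #A) :
    #A * #B ≤ 2 * #(distinctPairs A B) := by
  have h := card_filter_add_card_filter_not (s := A ×ˢ B) (fun p => p.1 - p.2 = 0)
  have hdiag : #{p ∈ A ×ˢ B | p.1 - p.2 = 0} ≤ #B := by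
    refine card_le_card_of_injOn Prod.snd ?_ ?_
    · intro p hp
      simp only [coe_filter, mem_product, Set.mem_ofPred_eq] at hp
      exact hp.1.2
    · intro p hp q hq hpq
      simp only [coe_filter, Set.mem_ofPred_eq] at hp hq
      exact Prod.ext (by linarith [hp.2, hq.2]) hpq
  rw [card_product] at h
  change _ + #(distinctPairs A B) = _ at h
  nlinarith

theorem sq_card_diffRatio_le (A B : Finset ℝ) {r : ℝ} (hr : r ≠ 0) :
    #{p ∈ distinctPairs A B ×ˢ distinctPairs A B | diffRatio p = r} ^ 2 ≤
      dilateEnergy A B r * dilateEnergy A B r⁻¹ := by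
  have hinj : #{p ∈ distinctPairs A B ×ˢ distinctPairs A B | diffRatio p = r} ≤
      #{p ∈ (A ×ˢ B) ×ˢ (B ×ˢ A) | p.1.1 + r * p.1.2 = p.2.1 + r * p.2.2} := by
    refine card_le_card_of_injOn (fun p => ((p.1.1, p.2.2), p.1.2, p.2.1)) ?_ ?_
    · intro p hp
      simp only [mem_coe, mem_filter, mem_product, mem_distinctPairs] at hp ⊢
      obtain ⟨⟨⟨h1, h2⟩, h3, h4⟩, h5⟩ := hp
      rw [diffRatio, div_eq_iff h4] at h5
      refine ⟨⟨⟨h1.1, h3.2⟩, h1.2, h3.1⟩, by linarith⟩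
    · rintro ⟨⟨a, b⟩, c, d⟩ _ ⟨⟨a', b'⟩, c', d'⟩ _ h
      simp only [Prod.mk.injEq] at h ⊢
      tauto
  calc _ ≤ #{p ∈ (A ×ˢ B) ×ˢ (B ×ˢ A) | p.1.1 + r * p.1.2 = p.2.1 + r * p.2.2} ^ 2 :=
        Nat.pow_le_pow_left hinj 2
    _ ≤ dilateEnergy A B r * dilateEnergy B A r :=
        sq_card_filter_eq_le (A ×ˢ B) (B ×ˢ A) (fun p => p.1 + r * p.2) fun p => p.1 + r * p.2
    _ ≤ _ := Nat.mul_le_mul_left _ (dilateEnergy_swap A B hr)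

theorem card_fiberPairs_diffRatio_le (A B : Finset ℝ) (hN : 0 < #A * #B) :
    #(fiberPairs (distinctPairs A B ×ˢ distinctPairs A B) diffRatio) ≤
      1032 * (Nat.log 2 ((#A * #B) ^ 2) + 1) * (#A * #B) ^ 3 := by
  classical
  set P := distinctPairs A B with hP
  set N := #A * #B with hNdef
  set W := (P ×ˢ P).image diffRatio with hW
  set n : ℝ → ℕ := fun r => #{p ∈ P ×ˢ P | diffRatio p = r} with hn
  set e : ℝ → ℕ := dilateEnergy A B with he
  have hW0 : ∀ r ∈ W, r ≠ 0 := by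
    intro r hr
    rw [hW, mem_image] at hr
    obtain ⟨p, hp, rfl⟩ := hr
    rw [mem_product, hP, mem_distinctPairs, mem_distinctPairs] at hp
    exact div_ne_zero hp.1.2 hp.2.2
  have hpoint : ∀ r ∈ W, n r ^ 2 ≤ 8 * N * n r + ((if 8 * N ≤ e r then e r ^ 2 else 0) +
      if 8 * N ≤ e r⁻¹ then e r⁻¹ ^ 2 else 0) := by
    intro r hr
    have h : n r ^ 2 ≤ e r * e r⁻¹ := sq_card_diffRatio_le A B (hW0 r hr)
    split_ifs with h1 h2 h2
    · nlinarith [sq_nonneg ((e r : ℤ) - e r⁻¹), two_mul_le_add_sq (e r) (e r⁻¹)]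
    · nlinarith
    · nlinarith
    · have : n r ≤ 8 * N := by
        by_contra hlt
        push Not at hlt h1 h2
        nlinarith
      nlinarith
  have hsum_n : ∑ r ∈ W, n r ≤ N ^ 2 := by
    rw [hn, hW, ← card_eq_sum_card_image, card_product, ← sq]
    refine Nat.pow_le_pow_left ?_ 2
    rw [hNdef, ← card_product]
    exact card_le_card (filter_subset _ _)
  have hsum_e : ∑ r ∈ W, (if 8 * N ≤ e r then e r ^ 2 else 0) ≤
      (Nat.log 2 (N ^ 2) + 1) * (512 * N ^ 3) := by
    rw [← sum_filter]
    exact sum_sq_dilateEnergy_le A B _ (fun h => hW0 0 (mem_filter.1 h).1 rfl) hN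
      fun r hr => (mem_filter.1 hr).2
  have hsum_inv : ∑ r ∈ W, (if 8 * N ≤ e r⁻¹ then e r⁻¹ ^ 2 else 0) ≤
      (Nat.log 2 (N ^ 2) + 1) * (512 * N ^ 3) := by
    rw [← sum_filter]
    have h := sum_sq_dilateEnergy_le A B ({r ∈ W | 8 * N ≤ e r⁻¹}.image fun r => r⁻¹) ?_ hN ?_
    · rwa [sum_image fun x _ y _ h => inv_injective h] at h
    · intro h
      obtain ⟨r, hr, hr0⟩ := mem_image.1 h
      exact hW0 r (mem_filter.1 hr).1 (inv_eq_zero.1 hr0)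
    · intro r hr
      obtain ⟨s, hs, rfl⟩ := mem_image.1 hr
      exact (mem_filter.1 hs).2
  rw [card_fiberPairs (P ×ˢ P) diffRatio W fun x hx => mem_image_of_mem _ hx]
  calc ∑ r ∈ W, n r ^ 2 ≤ ∑ r ∈ W, (8 * N * n r + ((if 8 * N ≤ e r then e r ^ 2 else 0) +
        if 8 * N ≤ e r⁻¹ then e r⁻¹ ^ 2 else 0)) := sum_le_sum hpoint
    _ ≤ 8 * N * N ^ 2 + ((Nat.log 2 (N ^ 2) + 1) * (512 * N ^ 3) +
        (Nat.log 2 (N ^ 2) + 1) * (512 * N ^ 3)) := by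
        rw [sum_add_distrib, sum_add_distrib, ← mul_sum]
        exact add_le_add (Nat.mul_le_mul_left _ hsum_n) (add_le_add hsum_e hsum_inv)
    _ ≤ _ := by nlinarith [Nat.zero_le (Nat.log 2 (N ^ 2) * N ^ 3)]

theorem card_fiberPairs_mul_diff_le (A B : Finset ℝ) :
    #(fiberPairs (distinctPairs A B ×ˢ distinctPairs A B)
        fun p => (p.1.1 - p.1.2) * (p.2.1 - p.2.2)) ≤
      #(fiberPairs (distinctPairs A B ×ˢ distinctPairs A B) diffRatio) := by
  refine card_le_card_of_injOn (fun p => ((p.1.1, p.2.1), p.2.2, p.1.2)) ?_ ?_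
  · intro p hp
    simp only [mem_coe, mem_fiberPairs, mem_product, diffRatio] at hp ⊢
    obtain ⟨⟨⟨h1, h2⟩, h3, h4⟩, h5⟩ := hp
    refine ⟨⟨⟨h1, h3⟩, h4, h2⟩, ?_⟩
    rw [div_eq_div_iff (mem_distinctPairs.1 h3).2 (mem_distinctPairs.1 h2).2]
    linarith
  · rintro ⟨⟨a, b⟩, c, d⟩ _ ⟨⟨a', b'⟩, c', d'⟩ _ h
    simp only [Prod.mk.injEq] at h ⊢
    tauto

theorem card_pow_four_le (A B : Finset ℝ) (hA : 2 ≤ #A) (hB : 0 < #B) :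
    (#A * #B) ^ 4 ≤ 16 * (#((A - B) * (A - B)) *
      (1032 * (Nat.log 2 ((#A * #B) ^ 2) + 1) * (#A * #B) ^ 3)) := by
  set P := distinctPairs A B with hP
  have h := sq_card_le_mul_card_fiberPairs (P ×ˢ P)
    (fun p => (p.1.1 - p.1.2) * (p.2.1 - p.2.2)) ((A - B) * (A - B)) (by
      intro p hp
      rw [mem_product, hP, mem_distinctPairs, mem_distinctPairs] at hp
      exact mul_mem_mul (sub_mem_sub hp.1.1.1 hp.1.1.2) (sub_mem_sub hp.2.1.1 hp.2.1.2))
  have hN : 0 < #A * #B := Nat.mul_pos (by omega) hB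
  calc (#A * #B) ^ 4 ≤ (2 * #P) ^ 4 :=
        Nat.pow_le_pow_left (card_le_two_mul_card_distinctPairs A B hA) 4
    _ = 16 * #(P ×ˢ P) ^ 2 := by rw [card_product]; ring
    _ ≤ _ := by
        refine Nat.mul_le_mul_left _ (h.trans (Nat.mul_le_mul_left _ ?_))
        exact (card_fiberPairs_mul_diff_le A B).trans (card_fiberPairs_diffRatio_le A B hN)

end Differences

theorem natLog_two_sq_add_one_le {N : ℕ} (hN : 4 ≤ N) :
    (Nat.log 2 (N ^ 2) : ℝ) + 1 ≤ 4 * Real.log N := by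
  have hlog2 := Real.log_two_gt_d9
  have hN4 : 2 * Real.log 2 ≤ Real.log N := by
    rw [← Nat.cast_two (R := ℝ), ← Real.log_pow]
    exact Real.log_le_log (by positivity) (by exact_mod_cast hN)
  have h : (Nat.log 2 (N ^ 2) : ℝ) * Real.log 2 ≤ 2 * Real.log N := by
    rw [← Nat.cast_two (R := ℝ), ← Real.log_pow, ← Real.log_pow]
    refine Real.log_le_log (by positivity) ?_
    exact_mod_cast Nat.pow_log_le_self 2 (pow_ne_zero 2 (by omega))
  have hlogN : 0 < Real.log N := by linarith
  nlinarith

/-- There is an absolute constant c > 0 such that for all finite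
sets A, B ⊆ ℝ with |A| ≥ 2 and |B| ≥ 2, one has
|(A - B)·(A - B)| ≥ c·|A||B|/(log|A| + log|B|). -/
theorem sum_product_estimate_2 :
    ∃ c : ℝ, 0 < c ∧
      ∀ A B : Finset ℝ, 2 ≤ A.card → 2 ≤ B.card →
        (((A - B) * (A - B)).card : ℝ) ≥
          c * A.card * B.card / (Real.log A.card + Real.log B.card) := by
  refine ⟨1 / 66048, by norm_num, fun A B hA hB => ?_⟩
  have hmain := card_pow_four_le A B hA (by omega)
  have hN : 4 ≤ A.card * B.card := Nat.mul_le_mul hA hB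
  have hlog := natLog_two_sq_add_one_le hN
  have hA0 : (A.card : ℝ) ≠ 0 := by positivity
  have hB0 : (B.card : ℝ) ≠ 0 := by positivity
  rw [← Real.log_mul hA0 hB0, ← Nat.cast_mul, mul_assoc, ← Nat.cast_mul, ge_iff_le]
  generalize A.card * B.card = N at *
  generalize ((A - B) * (A - B)).card = T at *
  have hNpos : (0 : ℝ) < N := by exact_mod_cast (by omega : 0 < N)
  have hlogN : 0 < Real.log N := Real.log_pos (by exact_mod_cast (by omega : 1 < N))
  rw [div_le_iff₀ hlogN]
  have hcast : (N : ℝ) ^ 4 ≤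
      16 * (T * (1032 * ((Nat.log 2 (N ^ 2) : ℝ) + 1) * (N : ℝ) ^ 3)) := by
    exact_mod_cast hmain
  have hN3 : (N : ℝ) * N ^ 3 ≤ 66048 * (T * Real.log N) * N ^ 3 :=
    calc (N : ℝ) * N ^ 3 = N ^ 4 := by ring
      _ ≤ 16 * (T * (1032 * (4 * Real.log N) * (N : ℝ) ^ 3)) := hcast.trans (by gcongr)
      _ = _ := by ring
  have := le_of_mul_le_mul_right hN3 (by positivity)
  linarith
end

section
/- There is an absolute constant c > 0 such that for all finite sets A, B ⊆ ℝ with |A| ≥ 2 and |B| ≥ 2, one has |(A+B)·(A+B)| ≥ c·|A||B|/(log|A| + log|B|). -/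
open Pointwise

open Finset in
/-- The number of elements of `X` below `x`. -/
noncomputable def rankIn (X : Finset ℝ) (x : ℝ) : ℕ := #{y ∈ X | y < x}

/-- The index of the block containing `x` when `X` is cut into at most `r` blocks of
`#X / r + 1` consecutive elements. -/
noncomputable def blockIndex (X : Finset ℝ) (r : ℕ) (x : ℝ) : ℕ :=
  rankIn X x / (X.card / r + 1)

open Finset in
/-- The abscissae in `X` of the points of `X × Y` on the line `y = ℓ.1 * x + ℓ.2`. -/
noncomputable def gridPoints (X Y : Finset ℝ) (ℓ : ℝ × ℝ) : Finset ℝ :=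
  {x ∈ X | ℓ.1 * x + ℓ.2 ∈ Y}

section

open Finset

theorem rankIn_mono (X : Finset ℝ) : Monotone (rankIn X) := fun _ _ h =>
  card_le_card (monotone_filter_right X fun _ _ hz => lt_of_lt_of_le hz h)

theorem rankIn_lt_of_lt {X : Finset ℝ} {x y : ℝ} (hx : x ∈ X) (h : x < y) :
    rankIn X x < rankIn X y := by
  refine card_lt_card (Finset.ssubset_iff_of_subset ?_ |>.2 ⟨x, by simp [hx, h], by simp⟩)
  exact monotone_filter_right X fun _ _ hz => lt_trans hz h

theorem rankIn_injOn (X : Finset ℝ) : Set.InjOn (rankIn X) X := by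
  intro x hx y hy h
  rcases lt_trichotomy x y with hxy | hxy | hxy
  · exact absurd h (rankIn_lt_of_lt hx hxy).ne
  · exact hxy
  · exact absurd h (rankIn_lt_of_lt hy hxy).ne'

theorem rankIn_lt_card {X : Finset ℝ} {x : ℝ} (hx : x ∈ X) : rankIn X x < #X :=
  card_lt_card (Finset.ssubset_iff_of_subset (filter_subset _ _) |>.2 ⟨x, hx, by simp⟩)

theorem blockIndex_mono (X : Finset ℝ) (r : ℕ) : Monotone (blockIndex X r) := fun _ _ h =>
  Nat.div_le_div_right (rankIn_mono X h)

theorem blockIndex_lt {X : Finset ℝ} {r : ℕ} (hr : 0 < r) {x : ℝ} (hx : x ∈ X) :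
    blockIndex X r x < r := by
  rw [blockIndex, Nat.div_lt_iff_lt_mul (Nat.succ_pos _), mul_comm]
  exact (rankIn_lt_card hx).trans (Nat.lt_mul_of_div_lt (Nat.lt_succ_self _) hr)

theorem card_block_le (X : Finset ℝ) (r i : ℕ) :
    #{x ∈ X | blockIndex X r x = i} ≤ #X / r + 1 := by
  have h : #{x ∈ X | blockIndex X r x = i} ≤
      #(Ico (i * (#X / r + 1)) ((i + 1) * (#X / r + 1))) := by
    refine card_le_card_of_injOn (rankIn X) ?_ ((rankIn_injOn X).mono ?_)
    · intro x hx
      replace hx := mem_filter.1 (mem_coe.1 hx)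
      rw [blockIndex] at hx
      have hw : 0 < #X / r + 1 := Nat.succ_pos _
      have := (Nat.div_eq_iff hw).1 hx.2
      simp only [coe_Ico, Set.mem_Ico]
      constructor
      · exact this.1
      · have h2 := this.2
        rw [add_mul]
        omega
    · intro x hx
      exact (mem_filter.1 hx).1
  refine h.trans ?_
  rw [Nat.card_Ico, add_mul]
  omega

theorem card_pairs_same_block_le (X : Finset ℝ) (r : ℕ) :
    #{p ∈ X ×ˢ X | blockIndex X r p.1 = blockIndex X r p.2} ≤ #X * (#X / r + 1) := by
  rw [card_eq_sum_card_fiberwise (f := Prod.fst) (t := X)]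
  · refine (sum_le_card_nsmul X _ (#X / r + 1) fun x _ => ?_).trans (by simp)
    refine le_trans ?_ (card_block_le X r (blockIndex X r x))
    refine card_le_card_of_injOn Prod.snd ?_ ?_
    · rintro ⟨y, z⟩ h
      simp only [coe_filter, mem_filter, mem_product, Set.mem_ofPred_eq] at h ⊢
      obtain ⟨⟨⟨_, hz⟩, h⟩, rfl⟩ := h
      exact ⟨hz, h.symm⟩
    · rintro ⟨y, z⟩ h ⟨y', z'⟩ h' hz
      simp only [coe_filter, mem_filter, mem_product, Set.mem_ofPred_eq] at h h' hz
      rw [h.2, h'.2, hz]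
  · rintro ⟨y, z⟩ h
    simp only [coe_filter, mem_product, Set.mem_ofPred_eq] at h
    exact h.1.1

theorem card_le_card_add_collisions {α β : Type*} [DecidableEq α] [DecidableEq β]
    {s : Finset α} {t : Finset β} {f : α → β} (hf : ∀ x ∈ s, f x ∈ t) :
    #s ≤ #t + #{p ∈ s.offDiag | f p.1 = f p.2} := by
  have hex : ∀ y : s.image f, ∃ x ∈ s, f x = y := fun y => mem_image.1 y.2
  choose g hgs hg using hex
  let u := univ.image g
  have hu : #u ≤ #t := card_image_le.trans (by
    rw [card_univ, Fintype.card_coe]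
    exact card_le_card (image_subset_iff.2 hf))
  have hsub : #(s \ u) ≤ #{p ∈ s.offDiag | f p.1 = f p.2} := by
    refine card_le_card_of_injOn
      (fun x => if h : x ∈ s then (x, g ⟨f x, mem_image_of_mem f h⟩) else (x, x)) ?_ ?_
    · intro x hx
      obtain ⟨hxs, hxu⟩ := mem_sdiff.1 (mem_coe.1 hx)
      simp only [hxs, dif_pos, coe_filter, mem_offDiag, Set.mem_ofPred_eq]
      refine ⟨⟨trivial, hgs _, fun h => hxu ?_⟩, (hg ⟨f x, mem_image_of_mem f hxs⟩).symm⟩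
      rw [h]
      exact mem_image_of_mem g (mem_univ _)
    · intro x hx y hy h
      have hxs := (mem_sdiff.1 (mem_coe.1 hx)).1
      have hys := (mem_sdiff.1 (mem_coe.1 hy)).1
      simp only [hxs, hys, dif_pos] at h
      exact congrArg Prod.fst h
  have := card_le_card_sdiff_add_card (s := s) (t := u)
  omega

theorem card_sq_le_card_mul_collisions {α β : Type*} [DecidableEq β]
    {s : Finset α} {t : Finset β} {f : α → β} (hf : ∀ x ∈ s, f x ∈ t) :
    #s ^ 2 ≤ #t * #{p ∈ s ×ˢ s | f p.1 = f p.2} := by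
  have h1 := card_eq_sum_card_fiberwise (f := f) (s := s) (t := t) hf
  have h2 : #{p ∈ s ×ˢ s | f p.1 = f p.2} = ∑ y ∈ t, #{x ∈ s | f x = y} ^ 2 := by
    rw [card_eq_sum_card_fiberwise (f := fun p => f p.1) (t := t)]
    · refine sum_congr rfl fun y _ => ?_
      rw [sq, ← card_product]
      congr 1
      ext ⟨x, z⟩
      simp only [mem_filter, mem_product]
      constructor
      · rintro ⟨⟨⟨hx, hz⟩, h⟩, rfl⟩
        exact ⟨⟨hx, rfl⟩, hz, h.symm⟩
      · rintro ⟨⟨hx, rfl⟩, hz, h⟩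
        exact ⟨⟨⟨hx, hz⟩, h.symm⟩, rfl⟩
    · rintro ⟨x, z⟩ h
      simp only [coe_filter, mem_product, Set.mem_ofPred_eq] at h
      exact hf _ h.1.1
  rw [h1, h2]
  exact sq_sum_le_card_mul_sum_sq

theorem card_gridPoints_le_add_pairs {X Y : Finset ℝ} {ℓ : ℝ × ℝ} (hℓ : ℓ.1 ≠ 0) {r : ℕ}
    (hr : 0 < r) :
    #(gridPoints X Y ℓ) ≤ (2 * r - 1) + #{p ∈ (gridPoints X Y ℓ).offDiag |
      blockIndex X r p.1 = blockIndex X r p.2 ∧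
      blockIndex Y r (ℓ.1 * p.1 + ℓ.2) = blockIndex Y r (ℓ.1 * p.2 + ℓ.2)} := by
  have hX : ∀ x ∈ gridPoints X Y ℓ, blockIndex X r x < r := fun x hx =>
    blockIndex_lt hr (mem_filter.1 hx).1
  have hY : ∀ x ∈ gridPoints X Y ℓ, blockIndex Y r (ℓ.1 * x + ℓ.2) < r := fun x hx =>
    blockIndex_lt hr (mem_filter.1 hx).2
  rcases hℓ.lt_or_gt with hneg | hpos
  · have h := card_le_card_add_collisions (s := gridPoints X Y ℓ) (t := range (2 * r - 1))
      (f := fun x => blockIndex X r x + (r - 1 - blockIndex Y r (ℓ.1 * x + ℓ.2))) (by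
        intro x hx
        have := hX x hx
        have := hY x hx
        simp only [mem_range]
        omega)
    rw [card_range] at h
    refine h.trans (Nat.add_le_add_left (card_le_card ?_) _)
    rintro ⟨x, y⟩ h
    simp only [mem_filter, mem_offDiag] at h ⊢
    refine ⟨h.1, ?_⟩
    have := hY x h.1.1
    have := hY y h.1.2.1
    rcases le_total x y with hxy | hxy
    · have h1 := blockIndex_mono X r hxy
      have h2 := blockIndex_mono Y r (by nlinarith : ℓ.1 * y + ℓ.2 ≤ ℓ.1 * x + ℓ.2)
      omega
    · have h1 := blockIndex_mono X r hxy
      have h2 := blockIndex_mono Y r (by nlinarith : ℓ.1 * x + ℓ.2 ≤ ℓ.1 * y + ℓ.2)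
      omega
  · have h := card_le_card_add_collisions (s := gridPoints X Y ℓ) (t := range (2 * r - 1))
      (f := fun x => blockIndex X r x + blockIndex Y r (ℓ.1 * x + ℓ.2)) (by
        intro x hx
        have := hX x hx
        have := hY x hx
        simp only [mem_range]
        omega)
    rw [card_range] at h
    refine h.trans (Nat.add_le_add_left (card_le_card ?_) _)
    rintro ⟨x, y⟩ h
    simp only [mem_filter, mem_offDiag] at h ⊢
    refine ⟨h.1, ?_⟩
    rcases le_total x y with hxy | hxy
    · have h1 := blockIndex_mono X r hxy
      have h2 := blockIndex_mono Y r (by nlinarith : ℓ.1 * x + ℓ.2 ≤ ℓ.1 * y + ℓ.2)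
      omega
    · have h1 := blockIndex_mono X r hxy
      have h2 := blockIndex_mono Y r (by nlinarith : ℓ.1 * y + ℓ.2 ≤ ℓ.1 * x + ℓ.2)
      omega

theorem line_eq_of_two_points {ℓ ℓ' : ℝ × ℝ} {x y : ℝ} (hxy : x ≠ y)
    (hx : ℓ.1 * x + ℓ.2 = ℓ'.1 * x + ℓ'.2) (hy : ℓ.1 * y + ℓ.2 = ℓ'.1 * y + ℓ'.2) :
    ℓ = ℓ' := by
  have h : (ℓ.1 - ℓ'.1) * (x - y) = 0 := by linear_combination hx - hy
  have h1 : ℓ.1 = ℓ'.1 := sub_eq_zero.1 ((mul_eq_zero.1 h).resolve_right (sub_ne_zero.2 hxy))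
  refine Prod.ext h1 ?_
  rw [h1] at hx
  linarith

/-- **Szemerédi–Trotter theorem** for Cartesian products: a grid of size `N` has
`O(N ^ 2 / k ^ 3)` lines, not parallel to the axes, containing at least `k` of its points. -/
theorem card_rich_lines_le {X Y : Finset ℝ} {S : Finset (ℝ × ℝ)} {k : ℕ} (hk : 2 ≤ k)
    (hS : ∀ ℓ ∈ S, ℓ.1 ≠ 0 ∧ k ≤ #(gridPoints X Y ℓ)) :
    k ^ 3 * #S ≤ 512 * (#X * #Y) ^ 2 := by
  rcases S.eq_empty_or_nonempty with rfl | ⟨ℓ₀, hℓ₀⟩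
  · simp
  have hkX : k ≤ #X := (hS ℓ₀ hℓ₀).2.trans (card_le_card (filter_subset _ _))
  have hkY : k ≤ #Y := (hS ℓ₀ hℓ₀).2.trans <| by
    refine card_le_card_of_injOn (fun x => ℓ₀.1 * x + ℓ₀.2) (fun x hx => (mem_filter.1 hx).2) ?_
    intro x _ y _ h
    exact mul_left_cancel₀ (hS ℓ₀ hℓ₀).1 (add_right_cancel h)
  obtain ⟨r, hr⟩ : ∃ r, r = (k + 2) / 4 := ⟨_, rfl⟩
  have hr0 : 0 < r := by omega
  set P : ℝ × ℝ → Finset (ℝ × ℝ) := fun ℓ => {p ∈ (gridPoints X Y ℓ).offDiag |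
      blockIndex X r p.1 = blockIndex X r p.2 ∧
      blockIndex Y r (ℓ.1 * p.1 + ℓ.2) = blockIndex Y r (ℓ.1 * p.2 + ℓ.2)} with hP
  have hlow : #S * k ≤ #S * (2 * r - 1) + ∑ ℓ ∈ S, #(P ℓ) := by
    rw [← smul_eq_mul, ← smul_eq_mul, ← sum_const, ← sum_const, ← sum_add_distrib]
    exact sum_le_sum fun ℓ hℓ =>
      (hS ℓ hℓ).2.trans (card_gridPoints_le_add_pairs (hS ℓ hℓ).1 hr0)
  have hup : ∑ ℓ ∈ S, #(P ℓ) ≤ (#X * (#X / r + 1)) * (#Y * (#Y / r + 1)) := by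
    rw [← card_sigma]
    refine le_trans ?_ (Nat.mul_le_mul (card_pairs_same_block_le X r)
      (card_pairs_same_block_le Y r))
    rw [← card_product]
    refine card_le_card_of_injOn
      (fun q => (q.2, (q.1.1 * q.2.1 + q.1.2, q.1.1 * q.2.2 + q.1.2))) ?_ ?_
    · rintro ⟨ℓ, x, y⟩ h
      simp only [hP, gridPoints, coe_sigma, Set.mem_sigma_iff, mem_coe, mem_filter,
        mem_offDiag, mem_product] at h ⊢
      tauto
    · rintro ⟨ℓ, x, y⟩ h ⟨ℓ', x', y'⟩ h' heq
      simp only [hP, coe_sigma, Set.mem_sigma_iff, mem_coe, mem_filter, mem_offDiag] at h h'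
      simp only [Prod.mk.injEq] at heq
      obtain ⟨⟨rfl, rfl⟩, h1, h2⟩ := heq
      obtain rfl := line_eq_of_two_points h.2.1.2.2 h1 h2
      rfl
  have hwX : r * (#X / r + 1) ≤ 2 * #X := by
    have := Nat.mul_div_le #X r
    rw [mul_add]
    omega
  have hwY : r * (#Y / r + 1) ≤ 2 * #Y := by
    have := Nat.mul_div_le #Y r
    rw [mul_add]
    omega
  have hk8 : k ≤ 8 * r := by omega
  have h2r : 2 * (2 * r - 1) ≤ k := by omega
  have hkS : k * #S ≤ 2 * ((#X * (#X / r + 1)) * (#Y * (#Y / r + 1))) := by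
    have := Nat.mul_le_mul_left #S h2r
    nlinarith
  calc k ^ 3 * #S = k ^ 2 * (k * #S) := by ring
    _ ≤ (8 * r) ^ 2 * (2 * ((#X * (#X / r + 1)) * (#Y * (#Y / r + 1)))) := by gcongr
    _ = 128 * (#X * #Y) * ((r * (#X / r + 1)) * (r * (#Y / r + 1))) := by ring
    _ ≤ 128 * (#X * #Y) * ((2 * #X) * (2 * #Y)) := by gcongr
    _ = 512 * (#X * #Y) ^ 2 := by ring

theorem cube_le_sum_three_mul_sq (n : ℕ) : n ^ 3 ≤ ∑ k ∈ Icc 1 n, 3 * k ^ 2 := by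
  induction n with
  | zero => simp
  | succ n ih =>
    rw [sum_Icc_succ_top (by omega)]
    calc (n + 1) ^ 3 ≤ n ^ 3 + 3 * (n + 1) ^ 2 := by ring_nf; omega
      _ ≤ _ := Nat.add_le_add_right ih _

theorem sum_cube_gridPoints_le {X Y : Finset ℝ} {S : Finset (ℝ × ℝ)}
    (hS : ∀ ℓ ∈ S, ℓ.1 ≠ 0 ∧ 2 ≤ #(gridPoints X Y ℓ)) :
    ∑ ℓ ∈ S, (#(gridPoints X Y ℓ) : ℝ) ^ 3 ≤
      1536 * (#X * #Y : ℝ) ^ 2 * (1 + Real.log #X) := by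
  have hle : ∀ ℓ, #(gridPoints X Y ℓ) ≤ #X := fun ℓ => card_le_card (filter_subset _ _)
  have h1 : ∑ ℓ ∈ S, #(gridPoints X Y ℓ) ^ 3 ≤
      ∑ k ∈ Icc 1 #X, 3 * k ^ 2 * #{ℓ ∈ S | k ≤ #(gridPoints X Y ℓ)} := by
    calc ∑ ℓ ∈ S, #(gridPoints X Y ℓ) ^ 3
        ≤ ∑ ℓ ∈ S, ∑ k ∈ Icc 1 #X, if k ≤ #(gridPoints X Y ℓ) then 3 * k ^ 2 else 0 := by
          refine sum_le_sum fun ℓ _ => (cube_le_sum_three_mul_sq _).trans_eq ?_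
          rw [← sum_filter]
          refine sum_congr ?_ fun _ _ => rfl
          ext k
          have := hle ℓ
          simp only [mem_Icc, mem_filter]
          omega
      _ = _ := by
          rw [sum_comm]
          refine sum_congr rfl fun k _ => ?_
          rw [← sum_filter, sum_const, smul_eq_mul, mul_comm]
  have h2 : ∀ k ∈ Icc 1 #X, ((3 * k ^ 2 * #{ℓ ∈ S | k ≤ #(gridPoints X Y ℓ)} : ℕ) : ℝ) ≤
      1536 * (#X * #Y : ℝ) ^ 2 * (k : ℝ)⁻¹ := by
    intro k hk
    have hk1 : 1 ≤ k := (mem_Icc.1 hk).1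
    have h3 : k ^ 3 * #{ℓ ∈ S | k ≤ #(gridPoints X Y ℓ)} ≤ 512 * (#X * #Y) ^ 2 := by
      rcases hk1.eq_or_lt with rfl | hk2
      · have := card_rich_lines_le le_rfl hS
        have := card_filter_le S fun ℓ => 1 ≤ #(gridPoints X Y ℓ)
        omega
      · exact card_rich_lines_le hk2 fun ℓ hℓ =>
          ⟨(hS ℓ (mem_filter.1 hℓ).1).1, (mem_filter.1 hℓ).2⟩
    have hkpos : (0 : ℝ) < k := by exact_mod_cast hk1
    have h4 : (k : ℝ) ^ 3 * #{ℓ ∈ S | k ≤ #(gridPoints X Y ℓ)} ≤ 512 * (#X * #Y : ℝ) ^ 2 := by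
      exact_mod_cast h3
    rw [← div_eq_mul_inv, le_div_iff₀ hkpos]
    push_cast
    nlinarith
  calc ∑ ℓ ∈ S, (#(gridPoints X Y ℓ) : ℝ) ^ 3
      ≤ ∑ k ∈ Icc 1 #X, ((3 * k ^ 2 * #{ℓ ∈ S | k ≤ #(gridPoints X Y ℓ)} : ℕ) : ℝ) := by
        exact_mod_cast h1
    _ ≤ ∑ k ∈ Icc 1 #X, 1536 * (#X * #Y : ℝ) ^ 2 * (k : ℝ)⁻¹ := sum_le_sum h2
    _ = 1536 * (#X * #Y : ℝ) ^ 2 * (harmonic #X : ℝ) := by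
        rw [harmonic_eq_sum_Icc, ← mul_sum]
        push_cast
        rfl
    _ ≤ _ := by
        gcongr
        exact harmonic_le_one_add_log _

/-- Solutions of `(a + b₁) * (b + a₁) = (a + b₂) * (b + a₂) ≠ 0`, stored as
`((a, b), (b₁, a₁), (b₂, a₂))`. -/
noncomputable def productCollisions (A B : Finset ℝ) :
    Finset ((ℝ × ℝ) × (ℝ × ℝ) × (ℝ × ℝ)) :=
  {t ∈ (A ×ˢ B) ×ˢ (B ×ˢ A) ×ˢ (B ×ˢ A) |
    (t.1.1 + t.2.1.1) * (t.1.2 + t.2.1.2) ≠ 0 ∧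
    (t.1.1 + t.2.1.1) * (t.1.2 + t.2.1.2) = (t.1.1 + t.2.2.1) * (t.1.2 + t.2.2.2)}

theorem card_filter_productCollisions_eq_le (A B : Finset ℝ) :
    #{t ∈ productCollisions A B | t.2.1.1 = t.2.2.1} ≤ (#A * #B) ^ 2 := by
  have : (#A * #B) ^ 2 = #((A ×ˢ B) ×ˢ (B ×ˢ A)) := by
    simp only [card_product]
    ring
  rw [this]
  refine card_le_card_of_injOn (fun t => (t.1, t.2.1)) ?_ ?_
  · rintro ⟨⟨a, b⟩, ⟨b₁, a₁⟩, b₂, a₂⟩ h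
    simp only [productCollisions, coe_filter, mem_filter, mem_product, Set.mem_ofPred_eq,
      mem_coe] at h ⊢
    tauto
  · rintro ⟨⟨a, b⟩, ⟨b₁, a₁⟩, b₂, a₂⟩ h ⟨⟨a', b'⟩, ⟨b₁', a₁'⟩, b₂', a₂'⟩ h' heq
    simp only [productCollisions, coe_filter, mem_filter, Set.mem_ofPred_eq, ne_eq, mul_eq_zero,
      not_or] at h h'
    simp only [Prod.mk.injEq] at heq
    obtain ⟨⟨rfl, rfl⟩, rfl, rfl⟩ := heq
    obtain ⟨⟨-, ⟨h0, -⟩, h1⟩, rfl⟩ := h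
    obtain ⟨⟨-, -, h1'⟩, rfl⟩ := h'
    have h2 := add_left_cancel (mul_left_cancel₀ h0 h1)
    have h2' := add_left_cancel (mul_left_cancel₀ h0 h1')
    rw [← h2, ← h2']

/-- The line through `(b₁, a₂)` and `(b₂, a₁)`. -/
noncomputable def collisionLine (t : (ℝ × ℝ) × (ℝ × ℝ) × (ℝ × ℝ)) : ℝ × ℝ :=
  ((t.2.1.2 - t.2.2.2) / (t.2.2.1 - t.2.1.1),
    t.2.2.2 - (t.2.1.2 - t.2.2.2) / (t.2.2.1 - t.2.1.1) * t.2.1.1)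

theorem collisionLine_spec {A B : Finset ℝ} {t : (ℝ × ℝ) × (ℝ × ℝ) × (ℝ × ℝ)}
    (ht : t ∈ productCollisions A B) (hne : t.2.1.1 ≠ t.2.2.1) :
    (collisionLine t).1 ≠ 0 ∧
    (collisionLine t).1 * t.2.1.1 + (collisionLine t).2 = t.2.2.2 ∧
    (collisionLine t).1 * t.2.2.1 + (collisionLine t).2 = t.2.1.2 ∧
    (collisionLine t).1 * t.1.1 + -(collisionLine t).2 = t.1.2 := by
  obtain ⟨⟨a, b⟩, ⟨b₁, a₁⟩, b₂, a₂⟩ := t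
  simp only [productCollisions, mem_filter, ne_eq, mul_eq_zero, not_or] at ht
  obtain ⟨-, ⟨h1, h2⟩, h⟩ := ht
  simp only at hne
  have hb : b₂ - b₁ ≠ 0 := sub_ne_zero.2 (Ne.symm hne)
  simp only [collisionLine]
  refine ⟨div_ne_zero (fun h0 => hb ?_) hb, by ring, by field_simp; ring, ?_⟩
  · have ha : a₁ = a₂ := sub_eq_zero.1 h0
    rw [← ha] at h
    have := mul_right_cancel₀ h2 h
    linarith
  · field_simp
    linear_combination h

theorem card_filter_productCollisions_ne_le (A B : Finset ℝ) :
    (#{t ∈ productCollisions A B | t.2.1.1 ≠ t.2.2.1} : ℝ) ≤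
      1536 * (#A * #B : ℝ) ^ 2 * (2 + (Real.log #A + Real.log #B)) := by
  set T := {t ∈ productCollisions A B | t.2.1.1 ≠ t.2.2.1} with hT
  set S := T.image collisionLine with hSdef
  let dual : ℝ × ℝ → ℝ × ℝ := fun ℓ => (ℓ.1, -ℓ.2)
  have hmem : ∀ t ∈ T, t.2.1.1 ∈ gridPoints B A (collisionLine t) ∧
      t.2.2.1 ∈ gridPoints B A (collisionLine t) ∧
      t.1.1 ∈ gridPoints A B (dual (collisionLine t)) := by
    intro t ht
    obtain ⟨ht, hne⟩ := mem_filter.1 ht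
    obtain ⟨-, h1, h2, h3⟩ := collisionLine_spec ht hne
    simp only [productCollisions, mem_filter, mem_product] at ht
    simp only [gridPoints, mem_filter, dual, h1, h2, h3]
    tauto
  have hS : ∀ ℓ ∈ S, ℓ.1 ≠ 0 ∧ 2 ≤ #(gridPoints B A ℓ) := by
    intro ℓ hℓ
    obtain ⟨t, ht, rfl⟩ := mem_image.1 hℓ
    obtain ⟨htC, hne⟩ := mem_filter.1 ht
    exact ⟨(collisionLine_spec htC hne).1,
      one_lt_card.2 ⟨_, (hmem t ht).1, _, (hmem t ht).2.1, hne⟩⟩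
  have hcount : #T ≤ ∑ ℓ ∈ S, #(gridPoints B A ℓ) ^ 2 * #(gridPoints A B (dual ℓ)) := by
    have : ∑ ℓ ∈ S, #(gridPoints B A ℓ) ^ 2 * #(gridPoints A B (dual ℓ)) =
        #(S.sigma fun ℓ =>
          (gridPoints B A ℓ ×ˢ gridPoints B A ℓ) ×ˢ gridPoints A B (dual ℓ)) := by
      simp only [card_sigma, card_product, sq]
    rw [this]
    refine card_le_card_of_injOn
      (fun t => ⟨collisionLine t, (t.2.1.1, t.2.2.1), t.1.1⟩) ?_ ?_
    · intro t ht
      simp only [coe_sigma, Set.mem_sigma_iff, mem_coe, mem_product]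
      have := hmem t ht
      exact ⟨mem_image_of_mem _ ht, ⟨this.1, this.2.1⟩, this.2.2⟩
    · intro t ht t' ht' heq
      obtain ⟨ht, hne⟩ := mem_filter.1 (mem_coe.1 ht)
      obtain ⟨ht', hne'⟩ := mem_filter.1 (mem_coe.1 ht')
      obtain ⟨-, h1, h2, h3⟩ := collisionLine_spec ht hne
      obtain ⟨-, h1', h2', h3'⟩ := collisionLine_spec ht' hne'
      simp only [Sigma.mk.injEq, heq_eq_eq, Prod.mk.injEq] at heq
      obtain ⟨hl, ⟨hb1, hb2⟩, ha⟩ := heq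
      rw [hl, hb1, h1'] at h1
      rw [hl, hb2, h2'] at h2
      rw [hl, ha, h3'] at h3
      exact Prod.ext (Prod.ext ha h3.symm) (Prod.ext (Prod.ext hb1 h2.symm)
        (Prod.ext hb2 h1.symm))
  have hdual : Function.Injective dual := fun ℓ ℓ' h => by
    simp only [dual, Prod.mk.injEq, neg_inj] at h
    exact Prod.ext h.1 h.2
  set S' := {ℓ ∈ S | 2 ≤ #(gridPoints A B (dual ℓ))} with hS'
  have hpt : ∀ ℓ ∈ S, (#(gridPoints B A ℓ) : ℝ) ^ 2 * #(gridPoints A B (dual ℓ)) ≤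
      (#(gridPoints B A ℓ) : ℝ) ^ 3 +
        if 2 ≤ #(gridPoints A B (dual ℓ)) then (#(gridPoints A B (dual ℓ)) : ℝ) ^ 3 else 0 := by
    intro ℓ hℓ
    have h2 := (hS ℓ hℓ).2
    generalize #(gridPoints B A ℓ) = i at h2 ⊢
    generalize #(gridPoints A B (dual ℓ)) = j
    have hnn : (0 : ℝ) ≤ if 2 ≤ j then (j : ℝ) ^ 3 else 0 := by positivity
    rcases le_total j i with hji | hij
    · calc (i : ℝ) ^ 2 * j ≤ (i : ℝ) ^ 2 * i := by gcongr
        _ ≤ _ := by linarith [pow_succ (i : ℝ) 2]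
    · rw [if_pos (h2.trans hij)]
      calc (i : ℝ) ^ 2 * j ≤ (j : ℝ) ^ 2 * j := by gcongr
        _ ≤ _ := by
          have : (0 : ℝ) ≤ (i : ℝ) ^ 3 := by positivity
          linarith [pow_succ (j : ℝ) 2]
  have hsum1 := sum_cube_gridPoints_le hS
  have hsum2 : ∑ ℓ ∈ S', (#(gridPoints A B (dual ℓ)) : ℝ) ^ 3 ≤
      1536 * (#A * #B : ℝ) ^ 2 * (1 + Real.log #A) := by
    rw [← sum_image (f := fun ℓ => (#(gridPoints A B ℓ) : ℝ) ^ 3) hdual.injOn]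
    refine sum_cube_gridPoints_le fun ℓ hℓ => ?_
    obtain ⟨ℓ, hℓ', rfl⟩ := mem_image.1 hℓ
    obtain ⟨h1, h2⟩ := mem_filter.1 hℓ'
    exact ⟨(hS ℓ h1).1, h2⟩
  calc (#T : ℝ) ≤ ∑ ℓ ∈ S, (#(gridPoints B A ℓ) : ℝ) ^ 2 * #(gridPoints A B (dual ℓ)) := by
        exact_mod_cast hcount
    _ ≤ _ := sum_le_sum hpt
    _ = ∑ ℓ ∈ S, (#(gridPoints B A ℓ) : ℝ) ^ 3 +
        ∑ ℓ ∈ S', (#(gridPoints A B (dual ℓ)) : ℝ) ^ 3 := by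
        rw [sum_add_distrib, hS', sum_filter]
    _ ≤ 1536 * (#B * #A : ℝ) ^ 2 * (1 + Real.log #B) +
        1536 * (#A * #B : ℝ) ^ 2 * (1 + Real.log #A) := add_le_add hsum1 hsum2
    _ = _ := by ring

theorem card_productCollisions_le (A B : Finset ℝ) :
    (#(productCollisions A B) : ℝ) ≤
      (#A * #B : ℝ) ^ 2 * (3073 + 1536 * (Real.log #A + Real.log #B)) := by
  have h1 : (#{t ∈ productCollisions A B | t.2.1.1 = t.2.2.1} : ℝ) ≤ (#A * #B : ℝ) ^ 2 := by
    exact_mod_cast card_filter_productCollisions_eq_le A B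
  have h2 := card_filter_productCollisions_ne_le A B
  have h3 : (#{t ∈ productCollisions A B | t.2.1.1 = t.2.2.1} : ℝ) +
      #{t ∈ productCollisions A B | t.2.1.1 ≠ t.2.2.1} = #(productCollisions A B) := by
    exact_mod_cast card_filter_add_card_filter_not _
  linarith

theorem card_sub_one_le_card_filter_add_ne_zero (A : Finset ℝ) (b : ℝ) :
    #A - 1 ≤ #{a ∈ A | b + a ≠ 0} := by
  refine (pred_card_le_card_erase (a := -b)).trans (card_le_card fun a ha => ?_)
  obtain ⟨h1, h2⟩ := mem_erase.1 ha
  exact mem_filter.2 ⟨h2, fun h => h1 (by linarith)⟩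

theorem card_cube_le_card_mul_productCollisions {A B : Finset ℝ} (hA : 2 ≤ #A) (hB : 2 ≤ #B) :
    (#A * #B) ^ 3 ≤ 16 * (#((A + B) * (A + B)) * #(productCollisions A B)) := by
  set Q : ℝ × ℝ → Finset (ℝ × ℝ) := fun p =>
    {b ∈ B | p.1 + b ≠ 0} ×ˢ {a ∈ A | p.2 + a ≠ 0} with hQ
  set f : ℝ × ℝ → ℝ × ℝ → ℝ := fun p q => (p.1 + q.1) * (p.2 + q.2) with hf
  have hlow : ∀ p, #A * #B ≤ 4 * #(Q p) := by
    intro p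
    have h1 := card_sub_one_le_card_filter_add_ne_zero A p.2
    have h2 := card_sub_one_le_card_filter_add_ne_zero B p.1
    rw [hQ, card_product]
    calc #A * #B ≤ (2 * #{a ∈ A | p.2 + a ≠ 0}) * (2 * #{b ∈ B | p.1 + b ≠ 0}) :=
          Nat.mul_le_mul (by omega) (by omega)
      _ = _ := by ring
  have hcs : ∀ p ∈ A ×ˢ B, (#A * #B) ^ 2 ≤
      16 * (#((A + B) * (A + B)) * #{q ∈ Q p ×ˢ Q p | f p q.1 = f p q.2}) := by
    intro p hp
    have := card_sq_le_card_mul_collisions (s := Q p) (t := (A + B) * (A + B)) (f := f p) (by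
      rintro ⟨b, a⟩ hq
      simp only [hQ, mem_product, mem_filter] at hp hq
      refine mul_mem_mul (add_mem_add hp.1 hq.1.1) ?_
      rw [add_comm p.2]
      exact add_mem_add hq.2.1 hp.2)
    calc (#A * #B) ^ 2 ≤ (4 * #(Q p)) ^ 2 := Nat.pow_le_pow_left (hlow p) 2
      _ = 16 * #(Q p) ^ 2 := by ring
      _ ≤ _ := Nat.mul_le_mul_left _ this
  have hcol : ∑ p ∈ A ×ˢ B, #{q ∈ Q p ×ˢ Q p | f p q.1 = f p q.2} ≤
      #(productCollisions A B) := by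
    rw [← card_sigma]
    refine card_le_card_of_injOn (fun x => (x.1, x.2)) ?_ ?_
    · rintro ⟨p, q, q'⟩ h
      simp only [hQ, hf, coe_sigma, Set.mem_sigma_iff, mem_coe, mem_filter, mem_product] at h
      simp only [productCollisions, mem_coe, mem_filter, mem_product]
      have := mul_ne_zero h.2.1.1.1.2 h.2.1.1.2.2
      tauto
    · rintro ⟨p, q⟩ _ ⟨p', q'⟩ _ h
      simp only [Prod.mk.injEq] at h
      obtain ⟨rfl, rfl⟩ := h
      rfl
  calc (#A * #B) ^ 3 = ∑ _p ∈ A ×ˢ B, (#A * #B) ^ 2 := by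
        rw [sum_const, card_product, smul_eq_mul]
        ring
    _ ≤ ∑ p ∈ A ×ˢ B,
        16 * (#((A + B) * (A + B)) * #{q ∈ Q p ×ˢ Q p | f p q.1 = f p q.2}) := sum_le_sum hcs
    _ = 16 * (#((A + B) * (A + B)) *
        ∑ p ∈ A ×ˢ B, #{q ∈ Q p ×ˢ Q p | f p q.1 = f p q.2}) := by
        rw [mul_sum, mul_sum]
    _ ≤ _ := by gcongr

end

/-- There is an absolute constant c > 0 such that for all finite
sets A, B ⊆ ℝ with |A| ≥ 2 and |B| ≥ 2, one has
|(A + B)·(A + B)| ≥ c·|A||B|/(log|A| + log|B|). -/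
theorem sum_product_estimate_3 :
    ∃ c : ℝ, 0 < c ∧
      ∀ A B : Finset ℝ, 2 ≤ A.card → 2 ≤ B.card →
        (((A + B) * (A + B)).card : ℝ) ≥
          c * A.card * B.card / (Real.log A.card + Real.log B.card) := by
  refine ⟨1 / 73744, by norm_num, fun A B hA hB => ?_⟩
  have hlog : ∀ n : ℕ, 2 ≤ n → 1 / 2 ≤ Real.log n := fun n hn => by
    have h1 := Real.log_le_log two_pos (by exact_mod_cast hn : (2 : ℝ) ≤ n)
    linarith [Real.log_two_gt_d9]
  have hL : 1 ≤ Real.log A.card + Real.log B.card := by linarith [hlog _ hA, hlog _ hB]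
  have h1 : ((A.card : ℝ) * B.card) ^ 3 ≤
      16 * (((A + B) * (A + B)).card * (productCollisions A B).card) := by
    exact_mod_cast card_cube_le_card_mul_productCollisions hA hB
  have h2 := card_productCollisions_le A B
  have hN : 0 < (A.card : ℝ) * B.card := by positivity
  set L := Real.log A.card + Real.log B.card
  set N := (A.card : ℝ) * B.card
  set D : ℝ := (((A + B) * (A + B)).card : ℝ)
  have hD : 0 ≤ D := Nat.cast_nonneg _
  have h3 : N ^ 2 * N ≤ N ^ 2 * (73744 * (D * L)) := by
    calc N ^ 2 * N = N ^ 3 := by ring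
      _ ≤ 16 * (D * (N ^ 2 * (3073 + 1536 * L))) := h1.trans (by gcongr)
      _ ≤ 16 * (D * (N ^ 2 * (4609 * L))) := by
          gcongr
          linarith
      _ = N ^ 2 * (73744 * (D * L)) := by ring
  have h4 := le_of_mul_le_mul_left h3 (by positivity)
  rw [ge_iff_le, div_le_iff₀ (by linarith), mul_assoc]
  linarith
end

section
/- Let p, q, s, t ∈ ℝ² with R(p,q) ≠ 0. Then R(p,q) = R(s,t) if and only if there exists a unique φ ∈ G_R such that either (φ(p) = s and φ(q) = t) or (φ(p) = t and φ(q) = s). -/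
/-- The rectangular area determined by two points of the plane. -/
noncomputable def rectArea (p q : ℝ × ℝ) : ℝ := (q.1 - p.1) * (q.2 - p.2)

/-- The group `G_R` of rectangle-preserving affine maps homotopic to the
identity: maps of the form `(a,b) ↦ (x + z·a, y + z⁻¹·b)` with `z > 0`. -/
def InGR (φ : ℝ × ℝ → ℝ × ℝ) : Prop :=
  ∃ x y z : ℝ, 0 < z ∧ ∀ a b : ℝ, φ (a, b) = (x + z * a, y + z⁻¹ * b)

theorem rectArea_comm (p q : ℝ × ℝ) : rectArea p q = rectArea q p := by
  unfold rectArea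
  ring

namespace InGR

variable {φ ψ : ℝ × ℝ → ℝ × ℝ} {p q : ℝ × ℝ}

theorem rectArea_map (hφ : InGR φ) (p q : ℝ × ℝ) :
    rectArea (φ p) (φ q) = rectArea p q := by
  obtain ⟨x, y, z, hz, hφ⟩ := hφ
  obtain ⟨a, b⟩ := p
  obtain ⟨c, d⟩ := q
  simp only [rectArea, hφ]
  field_simp
  ring

theorem mul_fst_sub_pos (hφ : InGR φ) (hpq : p.1 ≠ q.1) :
    0 < ((φ q).1 - (φ p).1) * (q.1 - p.1) := by
  obtain ⟨x, y, z, hz, hφ⟩ := hφ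
  obtain ⟨a, b⟩ := p
  obtain ⟨c, d⟩ := q
  simp only [hφ]
  have hac : c - a ≠ 0 := sub_ne_zero.2 hpq.symm
  calc 0 < z * (c - a) ^ 2 := by positivity
    _ = _ := by ring

/-- An element of `G_R` is determined by its values at two points with distinct abscissae. -/
theorem eq_of_apply_eq (hφ : InGR φ) (hψ : InGR ψ) (hpq : p.1 ≠ q.1)
    (hp : φ p = ψ p) (hq : φ q = ψ q) : φ = ψ := by
  obtain ⟨x, y, z, -, hφ⟩ := hφ
  obtain ⟨x', y', z', -, hψ⟩ := hψ
  obtain ⟨a, b⟩ := p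
  obtain ⟨c, d⟩ := q
  rw [hφ, hψ, Prod.mk.injEq] at hp hq
  have hz : z = z' :=
    mul_right_cancel₀ (sub_ne_zero.2 hpq) (by linear_combination hp.1 - hq.1)
  subst hz
  have hx : x = x' := by linarith [hp.1]
  have hy : y = y' := by linarith [hp.2]
  funext ⟨u, v⟩
  rw [hφ, hψ, hx, hy]

end InGR

theorem exists_inGR_of_rectArea_eq {p q s t : ℝ × ℝ}
    (hst : rectArea p q = rectArea s t) (hpos : 0 < (t.1 - s.1) * (q.1 - p.1)) :
    ∃ φ, InGR φ ∧ φ p = s ∧ φ q = t := by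
  obtain ⟨hz₁, hz₂⟩ := mul_ne_zero_iff.1 hpos.ne'
  have hz : 0 < (t.1 - s.1) / (q.1 - p.1) := by
    rw [div_eq_mul_inv]
    calc 0 < (t.1 - s.1) * (q.1 - p.1) * ((q.1 - p.1)⁻¹) ^ 2 := by positivity
      _ = _ := by field_simp
  have h₂ : t.2 - s.2 = ((t.1 - s.1) / (q.1 - p.1))⁻¹ * (q.2 - p.2) := by
    unfold rectArea at hst
    field_simp
    linear_combination -hst
  have h₁ : t.1 - s.1 = (t.1 - s.1) / (q.1 - p.1) * (q.1 - p.1) := by field_simp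
  generalize (t.1 - s.1) / (q.1 - p.1) = z at hz h₁ h₂
  refine ⟨fun u ↦ (s.1 - z * p.1 + z * u.1, s.2 - z⁻¹ * p.2 + z⁻¹ * u.2),
    ⟨_, _, z, hz, fun _ _ ↦ rfl⟩, Prod.ext ?_ ?_, Prod.ext ?_ ?_⟩
  · simp
  · simp
  · linear_combination -h₁
  · linear_combination -h₂

/-- For `p,q,s,t ∈ ℝ²` with `R(p,q) ≠ 0`, one has
`R(p,q) = R(s,t)` if and only if there exists a unique `φ ∈ G_R` with either
(`φ(p) = s` and `φ(q) = t`) or (`φ(p) = t` and `φ(q) = s`). -/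
theorem rect_quadruple_iff_unique_isometry (p q s t : ℝ × ℝ)
    (h : rectArea p q ≠ 0) :
    rectArea p q = rectArea s t ↔
      ∃! φ : ℝ × ℝ → ℝ × ℝ,
        InGR φ ∧ ((φ p = s ∧ φ q = t) ∨ (φ p = t ∧ φ q = s)) := by
  have hpq : p.1 ≠ q.1 := fun e ↦ h (by simp [rectArea, e])
  constructor
  · intro hst
    have hst₁ : t.1 ≠ s.1 := fun e ↦ h (hst.trans (by simp [rectArea, e]))
    refine existsUnique_of_exists_of_unique ?_ ?_
    · rcases (mul_ne_zero (sub_ne_zero.2 hst₁) (sub_ne_zero.2 hpq.symm)).lt_or_gt with hneg | hpos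
      · obtain ⟨φ, hφ, hp, hq⟩ := exists_inGR_of_rectArea_eq (s := t) (t := s)
          (hst.trans (rectArea_comm s t)) (by linarith)
        exact ⟨φ, hφ, .inr ⟨hp, hq⟩⟩
      · obtain ⟨φ, hφ, hp, hq⟩ := exists_inGR_of_rectArea_eq hst hpos
        exact ⟨φ, hφ, .inl ⟨hp, hq⟩⟩
    · rintro φ ψ ⟨hφ, hφ'⟩ ⟨hψ, hψ'⟩
      have hφ₀ := hφ.mul_fst_sub_pos hpq
      have hψ₀ := hψ.mul_fst_sub_pos hpq
      rcases hφ' with ⟨hp, hq⟩ | ⟨hp, hq⟩ <;> rcases hψ' with ⟨hp', hq'⟩ | ⟨hp', hq'⟩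
      · exact hφ.eq_of_apply_eq hψ hpq (hp.trans hp'.symm) (hq.trans hq'.symm)
      · rw [hp, hq] at hφ₀
        rw [hp', hq'] at hψ₀
        linarith
      · rw [hp, hq] at hφ₀
        rw [hp', hq'] at hψ₀
        linarith
      · exact hφ.eq_of_apply_eq hψ hpq (hp.trans hp'.symm) (hq.trans hq'.symm)
  · rintro ⟨φ, ⟨hφ, ⟨rfl, rfl⟩ | ⟨rfl, rfl⟩⟩, -⟩
    · exact (hφ.rectArea_map p q).symm
    · rw [hφ.rectArea_map, rectArea_comm]
end

section
/- Let p, q, s, t ∈ ℝ² with R(p,q) ≠ 0. Then R(p,q) = R(s,t) if and only if L_{ps} ∩ L_{qt} ≠ ∅ or L_{pt} ∩ L_{qs} ≠ ∅. -/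
/-- For `p, s ∈ ℝ²`, the set `L_{ps}` of elements of `G_R` taking `p` to `s`. -/
def Lset (p s : ℝ × ℝ) : Set (ℝ × ℝ → ℝ × ℝ) := {φ | InGR φ ∧ φ p = s}

/-- If two rectangles have equal nonzero area and their horizontal sides have the same sign,
then some element of `G_R` carries the corners of the first to those of the second. -/
theorem Lset_inter_nonempty_of_pos {p q s t : ℝ × ℝ} (h : rectArea p q ≠ 0)
    (hR : rectArea p q = rectArea s t) (hz : 0 < (t.1 - s.1) / (q.1 - p.1)) :
    (Lset p s ∩ Lset q t).Nonempty := by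
  obtain ⟨p₁, p₂⟩ := p
  obtain ⟨q₁, q₂⟩ := q
  obtain ⟨s₁, s₂⟩ := s
  obtain ⟨t₁, t₂⟩ := t
  simp only [rectArea] at h hR hz
  have hpq : q₁ - p₁ ≠ 0 := left_ne_zero_of_mul h
  have hst : t₁ - s₁ ≠ 0 := left_ne_zero_of_mul (hR ▸ h)
  set z := (t₁ - s₁) / (q₁ - p₁) with hzdef
  have hz₁ : z * (q₁ - p₁) = t₁ - s₁ := div_mul_cancel₀ _ hpq
  have hz₂ : z⁻¹ * (q₂ - p₂) = t₂ - s₂ := by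
    rw [hzdef, inv_div, div_mul_eq_mul_div, div_eq_iff hst, hR, mul_comm]
  have hG : InGR fun a ↦ (s₁ - z * p₁ + z * a.1, s₂ - z⁻¹ * p₂ + z⁻¹ * a.2) :=
    ⟨_, _, z, hz, fun _ _ ↦ rfl⟩
  refine ⟨_, ⟨hG, ?_⟩, hG, ?_⟩ <;> ext <;> dsimp only <;> linarith

/-- Elements of `G_R` preserve rectangular area. -/
theorem rectArea_eq_of_Lset_inter_nonempty {p q s t : ℝ × ℝ}
    (h : (Lset p s ∩ Lset q t).Nonempty) : rectArea p q = rectArea s t := by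
  obtain ⟨φ, ⟨⟨x, y, z, hz, hφ⟩, rfl⟩, -, rfl⟩ := h
  rw [← Prod.mk.eta (p := p), ← Prod.mk.eta (p := q), hφ, hφ]
  simp only [rectArea]
  field_simp
  ring

/-- For `p,q,s,t ∈ ℝ²` with `R(p,q) ≠ 0`, one has
`R(p,q) = R(s,t)` if and only if `L_{ps} ∩ L_{qt} ≠ ∅` or `L_{pt} ∩ L_{qs} ≠ ∅`. -/
theorem rect_quadruple_iff_lines_meet (p q s t : ℝ × ℝ)
    (h : rectArea p q ≠ 0) :
    rectArea p q = rectArea s t ↔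
      (Lset p s ∩ Lset q t).Nonempty ∨ (Lset p t ∩ Lset q s).Nonempty := by
  refine ⟨fun hR ↦ ?_, ?_⟩
  · have hpq : q.1 - p.1 ≠ 0 := left_ne_zero_of_mul h
    have hst : t.1 - s.1 ≠ 0 := left_ne_zero_of_mul (hR ▸ h : rectArea s t ≠ 0)
    rcases (div_ne_zero hst hpq).lt_or_gt with hz | hz
    · refine .inr (Lset_inter_nonempty_of_pos h (hR.trans (rectArea_comm s t)) ?_)
      rwa [← neg_sub, neg_div, neg_pos]
    · exact .inl (Lset_inter_nonempty_of_pos h hR hz)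
  · rintro (hL | hL)
    · exact rectArea_eq_of_Lset_inter_nonempty hL
    · exact (rectArea_eq_of_Lset_inter_nonempty hL).trans (rectArea_comm t s)
end

section
/- For p, q, s, t ∈ ℝ², the set L_{ps} ∩ L_{qt} contains at least two distinct elements if and only if p = q and s = t. -/
/-- Two elements of `G_R` that agree at two distinct points are equal. -/
theorem InGR.eq_of_eq_of_eq {φ ψ : ℝ × ℝ → ℝ × ℝ} (hφ : InGR φ) (hψ : InGR ψ)
    {p q : ℝ × ℝ} (hpq : p ≠ q) (hp : φ p = ψ p) (hq : φ q = ψ q) : φ = ψ := by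
  obtain ⟨x, y, z, -, hφ⟩ := hφ
  obtain ⟨x', y', z', -, hψ⟩ := hψ
  obtain ⟨a, b⟩ := p
  obtain ⟨c, d⟩ := q
  simp only [hφ, hψ, Prod.mk.injEq] at hp hq
  have hz : z = z' := by
    by_contra h
    have hac : (z - z') * (a - c) = 0 := by linear_combination hp.1 - hq.1
    have hbd : (z⁻¹ - z'⁻¹) * (b - d) = 0 := by linear_combination hp.2 - hq.2
    have h_inv : z⁻¹ - z'⁻¹ ≠ 0 := sub_ne_zero.mpr fun e => h (inv_injective e)
    exact hpq (Prod.ext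
      (sub_eq_zero.mp ((mul_eq_zero.mp hac).resolve_left (sub_ne_zero.mpr h)))
      (sub_eq_zero.mp ((mul_eq_zero.mp hbd).resolve_left h_inv)))
  subst hz
  funext ⟨u, v⟩
  rw [hφ, hψ, add_right_cancel hp.1, add_right_cancel hp.2]

/-- For every scaling factor `z > 0`, the set `L_{ps}` contains an element of `G_R` with that
factor. -/
theorem mem_Lset_of_pos (p s : ℝ × ℝ) {z : ℝ} (hz : 0 < z) :
    (fun u : ℝ × ℝ => (s.1 - z * p.1 + z * u.1, s.2 - z⁻¹ * p.2 + z⁻¹ * u.2)) ∈ Lset p s :=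
  ⟨⟨_, _, z, hz, fun _ _ => rfl⟩, by simp⟩

/-- The set `L_{ps}` contains two distinct elements. -/
theorem exists_ne_mem_Lset (p s : ℝ × ℝ) : ∃ φ ∈ Lset p s, ∃ ψ ∈ Lset p s, φ ≠ ψ := by
  refine ⟨_, mem_Lset_of_pos p s one_pos, _, mem_Lset_of_pos p s two_pos, fun h => ?_⟩
  have h₁ := congrArg Prod.fst (congrFun h (p.1 + 1, 0))
  dsimp only at h₁
  linarith

/-- For `p,q,s,t ∈ ℝ²`, the set `L_{ps} ∩ L_{qt}` contains at
least two distinct elements if and only if `p = q` and `s = t`. -/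
theorem Lset_inter_two_elements_iff (p q s t : ℝ × ℝ) :
    (∃ φ ∈ Lset p s ∩ Lset q t, ∃ ψ ∈ Lset p s ∩ Lset q t, φ ≠ ψ) ↔
      p = q ∧ s = t := by
  constructor
  · rintro ⟨φ, ⟨⟨hφ, hφp⟩, -, hφq⟩, ψ, ⟨⟨hψ, hψp⟩, -, hψq⟩, hne⟩
    have hpq : p = q := by
      by_contra h
      exact hne (hφ.eq_of_eq_of_eq hψ h (hφp.trans hψp.symm) (hφq.trans hψq.symm))
    subst hpq
    exact ⟨rfl, hφp.symm.trans hφq⟩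
  · rintro ⟨rfl, rfl⟩
    obtain ⟨φ, hφ, ψ, hψ, hne⟩ := exists_ne_mem_Lset p s
    exact ⟨φ, ⟨hφ, hφ⟩, ψ, ⟨hψ, hψ⟩, hne⟩
end
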